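/- arXiv:0912.5472 — 2 statements merged into one kernel-verified Lean document; each statement's English description precedes it below -/
import Mathlib

section
/- Let g be a finite-dimensional complex simple Lie algebra of rank 2, and let K and Φ satisfy the complexified system: each K_Z is skew with respect to ⟨·,·⟩ = −κ(·,·), Tr(K_Z ∘ ad_U) = 0 for all Z,U, (i) σ_{XYZ}⟨Φ(X,Y),Z⟩ = 0, and (ii) σ_{XYZ}([ad_{[X,Y]}, K_Z] + ad_{[K_X Y − K_Y X, Z]} + Φ(X,Y)∧Z) = 0. Then there exists a function φ : g → ℂ which is homogeneous of degree one (φ(cX) = cφ(X) for all c ∈ ℂ, X ∈ g), whose restriction to the centralizer of any nonzero element of g is ℂ-linear, and such that Φ(X,Y) = φ(Y)X − φ(X)Y for all X, Y ∈ g with [X,Y] = 0. -/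
open LieAlgebra

/-- The inner product `⟨X,Y⟩ = -κ(X,Y)`, the negative of the Killing form. -/
noncomputable def ip (R : Type*) (g : Type*) [CommRing R] [LieRing g] [LieAlgebra R g]
    (X Y : g) : R :=
  - killingForm R g X Y

/-- The endomorphism `X ∧ Y : Z ↦ ⟨X,Z⟩Y - ⟨Y,Z⟩X`, where `⟨·,·⟩ = -κ(·,·)`. -/
noncomputable def wedge (R : Type*) (g : Type*) [CommRing R] [LieRing g] [LieAlgebra R g]
    (X Y : g) : Module.End R g :=
  (-(killingForm R g X)).smulRight Y - (-(killingForm R g Y)).smulRight X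

namespace LieAlgebra

section KillingDual

variable {g : Type*} [LieRing g] [LieAlgebra ℂ g] {ι : Type*} [Fintype ι]

local notation "κ" => killingForm ℂ _

/-- Two finite families of vectors which are dual to each other for the Killing form. -/
def KillingDual (b d : ι → g) : Prop :=
  ∀ x, ∑ i, κ (d i) x • b i = x

lemma killingForm_symm (x y : g) : κ x y = κ y x :=
  LieModule.traceForm_comm ℂ g g x y

lemma killingForm_lie_left (z x y : g) : κ ⁅z, x⁆ y = - κ x ⁅z, y⁆ := by
  rw [← lie_skew, map_neg, LinearMap.neg_apply, killingForm, LieModule.traceForm_apply_lie_apply]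

lemma killingForm_ext [IsKilling ℂ g] {x y : g} (h : ∀ z, κ x z = κ y z) : x = y := by
  have := IsKilling.killingForm_nondegenerate ℂ g
  have h2 : κ x = κ y := LinearMap.ext h
  exact (LinearMap.BilinForm.Nondegenerate.ker_eq_bot this |> LinearMap.ker_eq_bot.mp) h2

lemma exists_killingDual (g : Type*) [LieRing g] [LieAlgebra ℂ g] [Module.Finite ℂ g]
    [IsKilling ℂ g] :
    ∃ b d : Fin (Module.finrank ℂ g) → g, KillingDual b d := by
  have hn := IsKilling.killingForm_nondegenerate ℂ g
  let b := Module.finBasis ℂ g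
  refine ⟨LinearMap.BilinForm.dualBasis (killingForm ℂ g) hn b, b, fun x ↦ ?_⟩
  conv_rhs => rw [← (LinearMap.BilinForm.dualBasis (killingForm ℂ g) hn b).sum_repr x]
  refine Finset.sum_congr rfl fun i _ ↦ ?_
  rw [LinearMap.BilinForm.dualBasis_repr_apply, killingForm_symm]

namespace KillingDual

variable {b d : ι → g} (h : KillingDual b d)
include h

lemma sum_symm {N : Type*} [AddCommGroup N] [Module ℂ N] (β : g →ₗ[ℂ] g →ₗ[ℂ] N) :
    ∑ i, β (b i) (d i) = ∑ i, β (d i) (b i) := by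
  have key : ∀ j, d j = ∑ i, κ (d i) (d j) • b i := fun j ↦ (h (d j)).symm
  calc ∑ j, β (b j) (d j) = ∑ j, ∑ i, κ (d i) (d j) • β (b j) (b i) := by
        refine Finset.sum_congr rfl fun j _ ↦ ?_
        conv_lhs => rw [key j]
        simp
    _ = ∑ j, ∑ i, κ (d i) (d j) • β (b i) (b j) := by
        rw [Finset.sum_comm]
        simp_rw [killingForm_symm (d _) (d _)]
    _ = ∑ i, β (d i) (b i) := by
        refine Finset.sum_congr rfl fun j _ ↦ ?_
        conv_rhs => rw [key j]
        simp

lemma symm : KillingDual d b := fun x ↦ by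
  have := h.sum_symm (LinearMap.mk₂ ℂ (fun u v ↦ κ u x • v) (by simp [add_smul])
    (by simp [mul_smul]) (by simp) (by intro c m n; simp [smul_comm c]))
  simpa [h x] using this

lemma trace_eq [Module.Finite ℂ g] (S : Module.End ℂ g) :
    LinearMap.trace ℂ g S = ∑ i, κ (d i) (S (b i)) := by
  have : S = ∑ i, (κ (d i)).smulRight (S (b i)) := by
    ext x
    conv_lhs => rw [← h x]
    simp
  conv_lhs => rw [this]
  simp

lemma sum_lie_left {N : Type*} [AddCommGroup N] [Module ℂ N] (β : g →ₗ[ℂ] g →ₗ[ℂ] N) (z : g) :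
    ∑ i, β ⁅z, b i⁆ (d i) = - ∑ i, β (b i) ⁅z, d i⁆ := by
  calc ∑ i, β ⁅z, b i⁆ (d i) = ∑ i, ∑ j, κ (d j) ⁅z, b i⁆ • β (b j) (d i) := by
        refine Finset.sum_congr rfl fun i _ ↦ ?_
        conv_lhs => rw [← h ⁅z, b i⁆]
        simp
    _ = ∑ j, ∑ i, κ (d j) ⁅z, b i⁆ • β (b j) (d i) := Finset.sum_comm
    _ = - ∑ j, ∑ i, κ (b i) ⁅z, d j⁆ • β (b j) (d i) := by
        simp_rw [← Finset.sum_neg_distrib, ← neg_smul]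
        refine Finset.sum_congr rfl fun j _ ↦ Finset.sum_congr rfl fun i _ ↦ ?_
        rw [killingForm_symm, killingForm_lie_left]
    _ = _ := by
        congr 1
        refine Finset.sum_congr rfl fun j _ ↦ ?_
        conv_rhs => rw [← h.symm ⁅z, d j⁆]
        simp

lemma sum_lie_lie [Module.Finite ℂ g] [IsKilling ℂ g] (u : g) : ∑ i, ⁅b i, ⁅d i, u⁆⁆ = u := by
  refine killingForm_ext fun v ↦ ?_
  rw [killingForm_symm u v, killingForm_apply_apply ℂ g v u, h.symm.trace_eq, map_sum,
    LinearMap.sum_apply]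
  refine Finset.sum_congr rfl fun i _ ↦ ?_
  rw [← lie_skew, map_neg, LinearMap.neg_apply, killingForm_lie_left, neg_neg]
  simp only [LinearMap.comp_apply, ad_apply]
  rw [← lie_skew u (d i), lie_neg, lie_skew]

end KillingDual

end KillingDual

section Casimir

open LieModule

variable {g : Type*} [LieRing g] [LieAlgebra ℂ g] {ι : Type*} [Fintype ι]

/-- The Casimir operator attached to a pair of dual families. -/
noncomputable def casimirEnd (V : Type*) [AddCommGroup V] [Module ℂ V] [LieRingModule g V]
    [LieModule ℂ g V] (b d : ι → g) : Module.End ℂ V :=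
  ∑ i, toEnd ℂ g V (b i) ∘ₗ toEnd ℂ g V (d i)

variable {V : Type*} [AddCommGroup V] [Module ℂ V] [LieRingModule g V] [LieModule ℂ g V]

lemma casimirEnd_apply (b d : ι → g) (v : V) : casimirEnd V b d v = ∑ i, ⁅b i, ⁅d i, v⁆⁆ := by
  simp [casimirEnd]

lemma KillingDual.lie_casimirEnd {b d : ι → g} (h : KillingDual b d) (z : g) (v : V) :
    ⁅z, casimirEnd V b d v⁆ = casimirEnd V b d ⁅z, v⁆ := by
  have := h.sum_lie_left (LinearMap.mk₂ ℂ (fun x y ↦ ⁅x, ⁅y, v⁆⁆) (by simp) (by simp) (by simp)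
    (by simp)) z
  simp only [LinearMap.mk₂_apply] at this
  simp only [casimirEnd_apply, lie_sum]
  have e : ∀ i, ⁅z, ⁅b i, ⁅d i, v⁆⁆⁆ =
      ⁅⁅z, b i⁆, ⁅d i, v⁆⁆ + ⁅b i, ⁅⁅z, d i⁆, v⁆⁆ + ⁅b i, ⁅d i, ⁅z, v⁆⁆⁆ := fun i ↦ by
    rw [leibniz_lie z (b i), leibniz_lie z (d i), lie_add, add_assoc]
  simp_rw [e, Finset.sum_add_distrib, this]
  simp

/-- The eigenspaces of the Casimir operator are Lie submodules. -/
noncomputable def KillingDual.casimirEigenspace {b d : ι → g} (h : KillingDual b d) (V : Type*)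
    [AddCommGroup V] [Module ℂ V] [LieRingModule g V] [LieModule ℂ g V] (c : ℂ) :
    LieSubmodule ℂ g V where
  __ := (casimirEnd V b d).eigenspace c
  lie_mem {x m} hm := by
    have hm : casimirEnd V b d m = c • m := Module.End.mem_eigenspace_iff.mp hm
    refine Module.End.mem_eigenspace_iff.mpr ?_
    rw [← h.lie_casimirEnd, hm, lie_smul]


open scoped ComplexOrder

/-- In a finite-dimensional representation, the eigenvalues of the semisimple element of an
`sl₂`-triple are integers. -/
lemma _root_.IsSl2Triple.exists_int_of_hasEigenvalue [Module.Finite ℂ V] {h e f : g}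
    (t : IsSl2Triple h e f) {μ : ℂ} (hμ : (toEnd ℂ g V h).HasEigenvalue μ) : ∃ z : ℤ, μ = z := by
  obtain ⟨v, hv⟩ := hμ.exists_hasEigenvector
  have hE (n : ℕ) : ⁅h, ((toEnd ℂ g V e) ^ n) v⁆ = (μ + 2 * n) • ((toEnd ℂ g V e) ^ n) v := by
    induction n with
    | zero => simpa using hv.apply_eq_smul
    | succ n ih =>
      rw [pow_succ', Module.End.mul_apply, toEnd_apply_apply, leibniz_lie h, t.lie_h_e_smul ℂ, ih,
        lie_smul, smul_lie, ← add_smul]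
      congr 1
      push_cast
      ring
  have hzero : ∃ n : ℕ, ((toEnd ℂ g V e) ^ n) v = 0 := by
    by_contra! contra
    have hs : (Set.range fun n : ℕ ↦ μ + 2 * n).Infinite :=
      Set.infinite_range_of_injective fun n m ↦ by simp
    exact hs ((toEnd ℂ g V h).eigenvectors_linearIndependent (Set.range fun n : ℕ ↦ μ + 2 * n)
      (fun s ↦ ((toEnd ℂ g V e) ^ s.2.choose) v)
      (fun s ↦ by
        have hs : μ + 2 * (s.2.choose : ℂ) = s := s.2.choose_spec
        rw [Module.End.hasEigenvector_iff, Module.End.mem_eigenspace_iff]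
        exact ⟨by rw [toEnd_apply_apply, hE, hs], contra _⟩)).finite
  obtain ⟨n, hn₁, hn₂⟩ := Nat.exists_not_and_succ_of_not_zero_of_exists
    (p := fun n ↦ ((toEnd ℂ g V e) ^ n) v = 0) (by simpa using hv.2) hzero
  have P : t.HasPrimitiveVectorWith (((toEnd ℂ g V e) ^ n) v) (μ + 2 * n) :=
    ⟨hn₁, hE n, by rwa [pow_succ', Module.End.mul_apply, toEnd_apply_apply] at hn₂⟩
  obtain ⟨k, hk⟩ := P.exists_nat
  exact ⟨k - 2 * n, by push_cast; linear_combination hk⟩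

lemma _root_.IsSl2Triple.nonneg_of_mem_roots [Module.Finite ℂ V] {h e f : g}
    (t : IsSl2Triple h e f) {μ : ℂ}
    (hμ : μ ∈ (toEnd ℂ g V h ∘ₗ toEnd ℂ g V h).charpoly.roots) : 0 ≤ μ := by
  rw [Polynomial.mem_roots (LinearMap.charpoly_monic _).ne_zero,
    ← Module.End.hasEigenvalue_iff_isRoot_charpoly] at hμ
  obtain ⟨v, hv⟩ := hμ.exists_hasEigenvector
  obtain ⟨ν, hν⟩ := IsAlgClosed.exists_pow_nat_eq μ (n := 2) (by norm_num)
  have hv' : ⁅h, ⁅h, v⁆⁆ = (ν ^ 2) • v := by rw [hν]; exact hv.apply_eq_smul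
  have : ∃ z : ℤ, ν = z := by
    by_cases hw : ⁅h, v⁆ + ν • v = 0
    · have : (toEnd ℂ g V h).HasEigenvalue (-ν) :=
        Module.End.hasEigenvalue_of_hasEigenvector (x := v) ⟨by
          rw [Module.End.mem_eigenspace_iff, toEnd_apply_apply, neg_smul]
          exact eq_neg_of_add_eq_zero_left hw, hv.2⟩
      obtain ⟨z, hz⟩ := t.exists_int_of_hasEigenvalue this
      exact ⟨-z, by push_cast; rw [← hz, neg_neg]⟩
    · have : (toEnd ℂ g V h).HasEigenvalue ν :=
        Module.End.hasEigenvalue_of_hasEigenvector (x := ⁅h, v⁆ + ν • v) ⟨by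
          rw [Module.End.mem_eigenspace_iff, toEnd_apply_apply, lie_add, hv', lie_smul, smul_add,
            smul_smul, sq, add_comm], hw⟩
      exact t.exists_int_of_hasEigenvalue this
  obtain ⟨z, rfl⟩ := this
  rw [← hν]
  exact_mod_cast sq_nonneg z

lemma _root_.IsSl2Triple.traceForm_nonneg [Module.Finite ℂ V] {h e f : g}
    (t : IsSl2Triple h e f) : 0 ≤ traceForm ℂ g V h h := by
  rw [traceForm_apply_apply,
    Module.End.trace_eq_sum_roots_charpoly_of_splits (IsAlgClosed.splits _)]
  exact Multiset.sum_nonneg fun _ ↦ t.nonneg_of_mem_roots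

lemma _root_.IsSl2Triple.killingForm_pos [Module.Finite ℂ g] {h e f : g}
    (t : IsSl2Triple h e f) : 0 < killingForm ℂ g h h := by
  refine lt_of_le_of_ne t.traceForm_nonneg fun h0 ↦ ?_
  rw [killingForm, traceForm_apply_apply,
    Module.End.trace_eq_sum_roots_charpoly_of_splits (IsAlgClosed.splits _)] at h0
  have h4 : (4 : ℂ) ∈ (toEnd ℂ g g h ∘ₗ toEnd ℂ g g h).charpoly.roots := by
    rw [Polynomial.mem_roots (LinearMap.charpoly_monic _).ne_zero,
      ← Module.End.hasEigenvalue_iff_isRoot_charpoly]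
    refine Module.End.hasEigenvalue_of_hasEigenvector (x := e) ⟨?_, t.e_ne_zero⟩
    rw [Module.End.mem_eigenspace_iff, LinearMap.comp_apply, toEnd_apply_apply, toEnd_apply_apply,
      t.lie_h_e_smul ℂ, lie_smul, t.lie_h_e_smul ℂ, smul_smul]
    norm_num
  have := Multiset.all_zero_of_le_zero_le_of_sum_eq_zero
    (fun _ ↦ t.nonneg_of_mem_roots) h0.symm _ h4
  norm_num at this

/-- Over a simple Lie algebra, every trace form is a multiple of the Killing form. -/
lemma exists_traceForm_eq_smul_killingForm [Module.Finite ℂ g] [IsSimple ℂ g] [IsKilling ℂ g]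
    (V : Type*) [AddCommGroup V] [Module ℂ V] [LieRingModule g V] [LieModule ℂ g V] :
    ∃ μ : ℂ, ∀ x y, traceForm ℂ g V x y = μ * killingForm ℂ g x y := by
  have : Nontrivial g := by
    by_contra h
    rw [not_nontrivial_iff_subsingleton] at h
    exact IsSimple.non_abelian (R := ℂ) (L := g) ⟨fun x y ↦ Subsingleton.elim _ _⟩
  have hn := IsKilling.killingForm_nondegenerate ℂ g
  let S : Module.End ℂ g :=
    (LinearMap.BilinForm.toDual (killingForm ℂ g) hn).symm.toLinearMap ∘ₗ traceForm ℂ g V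
  have hS (x : g) : killingForm ℂ g (S x) = traceForm ℂ g V x := by
    ext y
    simp only [S, LinearMap.comp_apply, LinearEquiv.coe_coe]
    exact LinearMap.BilinForm.apply_toDual_symm_apply (hB := hn) ..
  obtain ⟨μ, hμ⟩ := Module.End.exists_eigenvalue S
  obtain ⟨v, hv⟩ := hμ.exists_hasEigenvector
  let I : LieIdeal ℂ g :=
    { LinearMap.ker (traceForm ℂ g V - μ • killingForm ℂ g) with
      lie_mem := fun {x m} hm ↦ by
        have hm : (traceForm ℂ g V - μ • killingForm ℂ g) m = 0 := hm
        change (traceForm ℂ g V - μ • killingForm ℂ g) ⁅x, m⁆ = 0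
        ext y
        have := LinearMap.congr_fun hm ⁅x, y⁆
        have h1 : traceForm ℂ g V ⁅x, m⁆ y = - traceForm ℂ g V m ⁅x, y⁆ := by
          rw [← lie_skew, map_neg, LinearMap.neg_apply, traceForm_apply_lie_apply]
        simp only [LinearMap.sub_apply, LinearMap.smul_apply, LinearMap.zero_apply, smul_eq_mul,
          h1, killingForm_lie_left] at this ⊢
        linear_combination -this }
  have hI : I = ⊤ := (IsSimple.eq_bot_or_eq_top I).resolve_left fun h ↦ hv.2 <| by
    have : v ∈ I := by
      change (traceForm ℂ g V - μ • killingForm ℂ g) v = 0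
      rw [LinearMap.sub_apply, ← hS, hv.apply_eq_smul, map_smul, LinearMap.smul_apply, sub_self]
    simpa [h] using this
  refine ⟨μ, fun x y ↦ ?_⟩
  have hx : x ∈ I := hI ▸ LieSubmodule.mem_top x
  have hx : (traceForm ℂ g V - μ • killingForm ℂ g) x = 0 := hx
  simpa [sub_eq_zero] using LinearMap.congr_fun hx y

lemma KillingDual.casimirEnd_eigenvalue_nonneg [Module.Finite ℂ g] [IsSimple ℂ g] [IsKilling ℂ g]
    {b d : ι → g} (hbd : KillingDual b d) {h e f : g} (t : IsSl2Triple h e f)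
    [Module.Finite ℂ V] {c : ℂ} (hc : (casimirEnd V b d).HasEigenvalue c) : 0 ≤ c := by
  let E := hbd.casimirEigenspace V c
  have hE : ∀ v : E, casimirEnd V b d v = c • v := fun v ↦
    Module.End.mem_eigenspace_iff.mp v.2
  have : Nontrivial E := by
    obtain ⟨v, hv⟩ := hc.exists_hasEigenvector
    exact ⟨⟨v, hv.1⟩, 0, fun h0 ↦ hv.2 (congrArg Subtype.val h0)⟩
  have hcas : casimirEnd E b d = c • LinearMap.id := by
    ext v
    simp [← hE, casimirEnd_apply]
  obtain ⟨μ, hμ⟩ := exists_traceForm_eq_smul_killingForm (g := g) E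
  have h1 : c * Module.finrank ℂ E = μ * Module.finrank ℂ g := by
    have h2 := hbd.trace_eq LinearMap.id
    have h3 := congrArg (LinearMap.trace ℂ E) hcas
    rw [casimirEnd, map_sum, map_smul, LinearMap.trace_id] at h3
    simp_rw [← traceForm_apply_apply, hμ, killingForm_symm (b _)] at h3
    rw [LinearMap.trace_id] at h2
    rw [h2, Finset.mul_sum]
    exact h3.symm
  have h4 := hμ h h
  have hμ0 : 0 ≤ μ := by
    have h5 : μ = traceForm ℂ g E h h * (killingForm ℂ g h h)⁻¹ := by
      rw [h4, mul_inv_cancel_right₀ t.killingForm_pos.ne']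
    rw [h5]
    exact mul_nonneg t.traceForm_nonneg (RCLike.inv_pos_of_pos t.killingForm_pos |>.le)
  have hpos : (0 : ℂ) < Module.finrank ℂ E := by exact_mod_cast Module.finrank_pos
  have h6 : c = μ * Module.finrank ℂ g * (Module.finrank ℂ E : ℂ)⁻¹ := by
    rw [← h1, mul_inv_cancel_right₀ hpos.ne']
  rw [h6]
  exact mul_nonneg (mul_nonneg hμ0 (Nat.cast_nonneg _)) (RCLike.inv_pos_of_pos hpos |>.le)

end Casimir

section RankTwo

open LieModule IsKilling

variable {g : Type*} [LieRing g] [LieAlgebra ℂ g] [Module.Finite ℂ g]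
  {H : LieSubalgebra ℂ g} [H.IsCartanSubalgebra]

lemma card_weight_le_finrank : Fintype.card (Weight ℂ H g) ≤ Module.finrank ℂ g := by
  have h := LieSubmodule.iSupIndep_toSubmodule.mpr (iSupIndep_genWeightSpace' ℂ H g)
  classical
  refine le_trans (Fintype.card_le_of_injective (fun χ : Weight ℂ H g ↦
    (⟨χ, by simpa using χ.genWeightSpace_ne_bot⟩ :
      {χ : Weight ℂ H g // (genWeightSpace g χ).toSubmodule ≠ ⊥})) fun χ₁ χ₂ e ↦ ?_)
    h.subtype_ne_bot_le_finrank
  simpa using e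

variable [IsKilling ℂ g]

lemma exists_weight_isNonZero (hH : Module.finrank ℂ H = 2) :
    ∃ α : Weight ℂ H g, α.IsNonZero := by
  by_contra! h
  have := span_weight_isNonZero_eq_top ℂ g H
  have h0 : {α : Weight ℂ H g | α.IsNonZero} = ∅ := by ext; simp [h]
  rw [h0, Set.image_empty, Submodule.span_empty] at this
  have h2 : Module.finrank ℂ (Module.Dual ℂ H) = 2 := by rw [Subspace.dual_finrank_eq, hH]
  rw [← finrank_top, ← this, finrank_bot] at h2
  omega

lemma exists_weight_apply_coroot_ne_zero [IsSimple ℂ g] (hH : Module.finrank ℂ H = 2)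
    (α : Weight ℂ H g) (hα : α.IsNonZero) :
    ∃ β : Weight ℂ H g, β.IsNonZero ∧ β ≠ α ∧ β ≠ -α ∧ β (coroot α) ≠ 0 := by
  by_contra! hcon
  let P := rootSystem H
  have htop : Submodule.span ℂ {(α : Module.Dual ℂ H)} = ⊤ := by
    refine RootPairing.IsIrreducible.eq_top_of_invtSubmodule_reflection (P := P) _ (fun i ↦ ?_) ?_
    · rw [Module.End.mem_invtSubmodule, Submodule.span_singleton_le_iff_mem]
      change P.reflection i (α : Module.Dual ℂ H) ∈ Submodule.span ℂ {(α : Module.Dual ℂ H)}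
      have hi : i.1.IsNonZero := (Finset.mem_filter.mp i.2).2
      let j : H.root := ⟨α, by simpa using hα⟩
      have hr : P.reflection i (P.root j) = P.root j - P.pairing j i • P.root i :=
        P.reflection_apply_root i j
      change P.reflection i (P.root j) ∈ _
      rw [hr]
      refine sub_mem (Submodule.mem_span_singleton_self _) ?_
      by_cases h1 : i.1 = α
      · have : i = j := Subtype.ext h1
        rw [this]
        exact Submodule.smul_mem _ _ (Submodule.mem_span_singleton_self _)
      by_cases h2 : i.1 = -α
      · have : P.root i = -P.root j := by
          ext x
          simp [P, j, h2]
        rw [this, smul_neg]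
        exact neg_mem (Submodule.smul_mem _ _ (Submodule.mem_span_singleton_self _))
      · have h0 : P.pairing i j = 0 := hcon i.1 hi h1 h2
        rw [RootPairing.pairing_eq_zero_iff.mp h0, zero_smul]
        exact zero_mem _
    · rw [Ne, Submodule.span_singleton_eq_bot]
      exact fun h ↦ hα (by ext x; exact LinearMap.congr_fun h x)
  have h2 : Module.finrank ℂ (Module.Dual ℂ H) = 2 := by rw [Subspace.dual_finrank_eq, hH]
  have h1 := finrank_span_le_card (R := ℂ) {(α : Module.Dual ℂ H)}
  rw [htop, finrank_top, h2] at h1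
  simp at h1

lemma seven_le_finrank [IsSimple ℂ g] (hH : Module.finrank ℂ H = 2) :
    7 ≤ Module.finrank ℂ g := by
  obtain ⟨α, hα⟩ := exists_weight_isNonZero (g := g) hH
  obtain ⟨β, hβ, h1, h2, h3⟩ := exists_weight_apply_coroot_ne_zero hH α hα
  have : Nontrivial g := ⟨α.exists_ne_zero.choose, 0, α.exists_ne_zero.choose_spec.2⟩
  have key (k : ℂ) (h : (β : H → ℂ) = k • (α : H → ℂ)) : False :=
    (eq_neg_or_eq_of_eq_smul α β hβ k h).elim h2 h1
  refine le_trans ?_ (card_weight_le_finrank (H := H))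
  let C : List (ℂ × ℂ) := [(0, 0), (1, 0), (-1, 0), (0, 1), (0, -1), (-β (coroot α), 1),
    (β (coroot α), -1)]
  let F (c : ℂ × ℂ) : H → ℂ := c.1 • ⇑α + c.2 • ⇑β
  have hF : Function.Injective F := by
    rintro ⟨p, q⟩ ⟨p', q'⟩ hpq
    have hpq : p • ⇑α + q • ⇑β = p' • ⇑α + q' • ⇑β := hpq
    have h4 : (q - q') • ⇑β = (p' - p) • ⇑α := by
      rw [sub_smul, sub_smul, sub_eq_sub_iff_add_eq_add, add_comm, hpq]
    have hq : q = q' := by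
      by_contra hne
      refine key ((q - q')⁻¹ * (p' - p)) ?_
      rw [mul_smul, ← h4, smul_smul, inv_mul_cancel₀ (sub_ne_zero.mpr hne), one_smul]
    subst hq
    rw [sub_self, zero_smul, eq_comm, smul_eq_zero] at h4
    have hp := sub_eq_zero.mp (h4.resolve_right hα)
    rw [hp]
  have hC : C.Nodup := by
    simp [C, h3, h3.symm, eq_neg_iff_add_eq_zero, neg_eq_iff_add_eq_zero]
  have hnd : [0, α, -α, β, -β, reflectRoot α β, -reflectRoot α β].Nodup := by
    refine List.Nodup.of_map (fun χ : Weight ℂ H g ↦ (χ : H → ℂ)) ?_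
    convert! hC.map hF using 1
    simp only [C, F, reflectRoot]
    simp [sub_eq_add_neg, add_comm]
  simpa using hnd.length_le_card

end RankTwo

section Bianchi

variable {g : Type*} [LieRing g] [LieAlgebra ℂ g]

local notation "κ" => killingForm ℂ _
local notation "tr" => LinearMap.trace ℂ _

lemma ad_lie_eq (x y : g) : ad ℂ g ⁅x, y⁆ = ad ℂ g x * ad ℂ g y - ad ℂ g y * ad ℂ g x := by
  ext z
  simp

lemma killingForm_eq_trace_mul (x y : g) : κ x y = tr (ad ℂ g x * ad ℂ g y) := rfl

variable [Module.Finite ℂ g]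

lemma trace_smulRight_mul (f : Module.Dual ℂ g) (x : g) (S : Module.End ℂ g) :
    tr (f.smulRight x * S) = f (S x) := by
  have : f.smulRight x * S = (f ∘ₗ S).smulRight x := rfl
  rw [this, LinearMap.trace_smulRight, LinearMap.comp_apply]

variable [IsKilling ℂ g]

lemma trace_eq_of_adjoint {S S' : Module.End ℂ g} (h : ∀ u v, κ (S u) v = κ u (S' v)) :
    tr S = tr S' := by
  obtain ⟨b, d, hbd⟩ := exists_killingDual g
  rw [hbd.trace_eq, hbd.symm.trace_eq]
  exact Finset.sum_congr rfl fun i _ ↦ by rw [killingForm_symm, h]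

lemma trace_skew_mul_ad_mul_ad {S : Module.End ℂ g} (h : ∀ u v, κ (S u) v = - κ u (S v))
    (u v : g) : tr (S * ad ℂ g u * ad ℂ g v) = tr (S * ad ℂ g ⁅u, v⁆) / 2 := by
  have h1 : tr (S * ad ℂ g u * ad ℂ g v) = tr (-(ad ℂ g v * ad ℂ g u * S)) :=
    trace_eq_of_adjoint fun x y ↦ by
      simp only [Module.End.mul_apply, ad_apply, LinearMap.neg_apply, h, killingForm_lie_left,
        map_neg]
      simp
  rw [map_neg, LinearMap.trace_mul_comm ℂ (ad ℂ g v * ad ℂ g u), ← mul_assoc] at h1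
  rw [ad_lie_eq, mul_sub, map_sub, ← mul_assoc, ← mul_assoc]
  linear_combination h1 / 2

/-- An alternating bilinear map satisfying the Bianchi identity for the adjoint representation is
a function of the bracket. -/
lemma exists_eq_apply_lie_of_bianchi (Ψ : g →ₗ[ℂ] g →ₗ[ℂ] g) (halt : ∀ x y, Ψ x y = - Ψ y x)
    (hB : ∀ x y z, ⁅Ψ x y, z⁆ + ⁅Ψ y z, x⁆ + ⁅Ψ z x, y⁆ = 0) :
    ∃ θ : Module.End ℂ g, ∀ x y, Ψ x y = θ ⁅x, y⁆ := by
  obtain ⟨b, d, hbd⟩ := exists_killingDual g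
  have hs (x y z w : g) : κ (Ψ x y) ⁅z, w⁆ = - κ (Ψ y x) ⁅z, w⁆ := by rw [halt x y]; simp
  have hs' (x y z w : g) : κ (Ψ x y) ⁅z, w⁆ = - κ (Ψ x y) ⁅w, z⁆ := by rw [← lie_skew z w, map_neg]
  have hc (x y z w : g) : κ (Ψ x y) ⁅z, w⁆ + κ (Ψ y z) ⁅x, w⁆ + κ (Ψ z x) ⁅y, w⁆ = 0 := by
    have := congrArg (fun t ↦ κ t w) (hB x y z)
    simpa [killingForm, LieModule.traceForm_apply_lie_apply] using this
  have hpair (x y z w : g) : κ (Ψ x y) ⁅z, w⁆ = κ (Ψ z w) ⁅x, y⁆ := by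
    have h1 := hc x y z w
    have h2 := hc y z w x
    have h3 := hc z w x y
    have h4 := hc w x y z
    rw [hs' y z w x, hs' z w y x, hs w y z x] at h2
    rw [hs w x z y, hs' x w z y, hs x z w y, hs' z x w y] at h3
    rw [hs w x y z, hs' x y w z, hs' y w x z] at h4
    linear_combination (h1 + h2 - h3 - h4) / 2
  let θ : Module.End ℂ g := ∑ i, Ψ (b i) ∘ₗ ad ℂ g (d i)
  have hθ (u : g) : θ u = ∑ i, Ψ (b i) ⁅d i, u⁆ := by simp [θ]
  have h1 (x y u : g) : κ (Ψ x y) u = κ (θ u) ⁅x, y⁆ := by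
    conv_lhs => rw [← hbd.sum_lie_lie u]
    rw [hθ, map_sum, map_sum, LinearMap.sum_apply]
    exact Finset.sum_congr rfl fun i _ ↦ hpair ..
  refine ⟨θ, fun x y ↦ killingForm_ext fun v ↦ ?_⟩
  rw [← hbd.sum_lie_lie v, map_sum, map_sum]
  refine Finset.sum_congr rfl fun i _ ↦ ?_
  rw [hpair, h1]

end Bianchi

section BilinearMaps

variable {g : Type*} [LieRing g] [LieAlgebra ℂ g]

local notation "κ" => killingForm ℂ _

/-- The Lie submodule of bilinear maps which are linear functions of the bracket. -/
def bracketFactor (g : Type*) [LieRing g] [LieAlgebra ℂ g] :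
    LieSubmodule ℂ g (g →ₗ[ℂ] g →ₗ[ℂ] g) where
  carrier := {m | ∃ q : Module.End ℂ g, ∀ x y, m x y = q ⁅x, y⁆}
  add_mem' := by
    rintro m m' ⟨q, hq⟩ ⟨q', hq'⟩
    exact ⟨q + q', fun x y ↦ by simp [hq, hq']⟩
  zero_mem' := ⟨0, fun x y ↦ by simp⟩
  smul_mem' := by
    rintro c m ⟨q, hq⟩
    exact ⟨c • q, fun x y ↦ by simp [hq]⟩
  lie_mem := by
    rintro z m ⟨q, hq⟩
    refine ⟨ad ℂ g z * q - q * ad ℂ g z, fun x y ↦ ?_⟩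
    simp only [LieHom.lie_apply, LinearMap.sub_apply, hq, Module.End.mul_apply, ad_apply,
      leibniz_lie z x y, map_add]
    abel

/-- The bilinear map `(x, y) ↦ σ y • x - σ x • y`. -/
def alternatingOf (σ : Module.Dual ℂ g) : g →ₗ[ℂ] g →ₗ[ℂ] g :=
  LinearMap.mk₂ ℂ (fun x y ↦ σ y • x - σ x • y)
    (fun _ _ _ ↦ by simp only [map_add, smul_add, add_smul]; abel)
    (fun _ _ _ ↦ by simp [smul_sub, smul_smul, mul_comm])
    (fun _ _ _ ↦ by simp only [map_add, smul_add, add_smul]; abel)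
    (fun _ _ _ ↦ by simp [smul_sub, smul_smul, mul_comm])

@[simp]
lemma alternatingOf_apply (σ : Module.Dual ℂ g) (x y : g) :
    alternatingOf σ x y = σ y • x - σ x • y := rfl

lemma lie_alternatingOf (σ : Module.Dual ℂ g) (z : g) :
    ⁅z, alternatingOf σ⁆ = alternatingOf (-(σ ∘ₗ ad ℂ g z)) := by
  ext x y
  simp [LieHom.lie_apply]
  abel

variable {ι : Type*} [Fintype ι] {b d : ι → g} (hbd : KillingDual b d)
include hbd

lemma KillingDual.casimirEnd_alternatingOf [Module.Finite ℂ g] [IsKilling ℂ g]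
    (σ : Module.Dual ℂ g) :
    casimirEnd (g →ₗ[ℂ] g →ₗ[ℂ] g) b d (alternatingOf σ) = alternatingOf σ := by
  rw [casimirEnd_apply]
  ext x y
  have h (z : g) : ∑ i, σ ⁅d i, ⁅b i, z⁆⁆ = σ z := by rw [← map_sum, hbd.symm.sum_lie_lie]
  simp [lie_alternatingOf, LinearMap.sum_apply, ← Finset.sum_smul, h]

lemma KillingDual.casimirEnd_bilinear [Module.Finite ℂ g] [IsKilling ℂ g]
    (m : g →ₗ[ℂ] g →ₗ[ℂ] g) (x y w : g) :
    κ (casimirEnd (g →ₗ[ℂ] g →ₗ[ℂ] g) b d m x y) w = 3 * κ (m x y) w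
      + 2 * ∑ i, κ (m ⁅d i, x⁆ y) ⁅b i, w⁆ + 2 * ∑ i, κ (m x ⁅d i, y⁆) ⁅b i, w⁆
      + 2 * ∑ i, κ (m ⁅b i, x⁆ ⁅d i, y⁆) w := by
  have e (i : ι) : κ (⁅b i, ⁅d i, m⁆⁆ x y) w =
      κ ⁅b i, ⁅d i, m x y⁆⁆ w + κ (m ⁅d i, ⁅b i, x⁆⁆ y) w + κ (m x ⁅d i, ⁅b i, y⁆⁆) w
      + κ (m ⁅d i, x⁆ y) ⁅b i, w⁆ + κ (m ⁅b i, x⁆ y) ⁅d i, w⁆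
      + κ (m x ⁅d i, y⁆) ⁅b i, w⁆ + κ (m x ⁅b i, y⁆) ⁅d i, w⁆
      + κ (m ⁅b i, x⁆ ⁅d i, y⁆) w + κ (m ⁅d i, x⁆ ⁅b i, y⁆) w := by
    simp only [LieHom.lie_apply, LinearMap.sub_apply, lie_sub, map_sub, killingForm_lie_left]
    ring
  have s1 : ∑ i, κ (m ⁅b i, x⁆ y) ⁅d i, w⁆ = ∑ i, κ (m ⁅d i, x⁆ y) ⁅b i, w⁆ := by
    exact hbd.sum_symm (LinearMap.mk₂ ℂ (fun s t ↦ κ (m ⁅s, x⁆ y) ⁅t, w⁆)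
      (by simp) (by simp) (by simp) (by simp))
  have s2 : ∑ i, κ (m x ⁅b i, y⁆) ⁅d i, w⁆ = ∑ i, κ (m x ⁅d i, y⁆) ⁅b i, w⁆ := by
    exact hbd.sum_symm (LinearMap.mk₂ ℂ (fun s t ↦ κ (m x ⁅s, y⁆) ⁅t, w⁆)
      (by simp) (by simp) (by simp) (by simp))
  have s3 : ∑ i, κ (m ⁅b i, x⁆ ⁅d i, y⁆) w = ∑ i, κ (m ⁅d i, x⁆ ⁅b i, y⁆) w := by
    exact hbd.sum_symm (LinearMap.mk₂ ℂ (fun s t ↦ κ (m ⁅s, x⁆ ⁅t, y⁆) w)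
      (by simp) (by simp) (by simp) (by simp))
  have t1 : ∑ i, κ ⁅b i, ⁅d i, m x y⁆⁆ w = κ (m x y) w := by
    conv_rhs => rw [← hbd.sum_lie_lie (m x y)]
    simp
  have t2 : ∑ i, κ (m ⁅d i, ⁅b i, x⁆⁆ y) w = κ (m x y) w := by
    conv_rhs => rw [← hbd.symm.sum_lie_lie x]
    simp
  have t3 : ∑ i, κ (m x ⁅d i, ⁅b i, y⁆⁆) w = κ (m x y) w := by
    conv_rhs => rw [← hbd.symm.sum_lie_lie y]
    simp
  rw [casimirEnd_apply]
  simp only [LinearMap.sum_apply, map_sum, e, Finset.sum_add_distrib, s1, s2, ← s3, t1, t2, t3]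
  ring

/-- Summing an alternating bilinear map against a dual pair of families. -/
lemma KillingDual.sum_lie_lie_of_alternating (β : g →ₗ[ℂ] g →ₗ[ℂ] ℂ)
    (halt : ∀ x y, β x y = - β y x) (x y : g) :
    2 * ∑ i, β ⁅b i, x⁆ ⁅d i, y⁆ = ∑ i, β (b i) ⁅⁅x, y⁆, d i⁆ := by
  have h1 : ∑ i, β ⁅b i, x⁆ ⁅d i, y⁆ = - ∑ i, β (b i) ⁅y, ⁅x, d i⁆⁆ := by
    have := hbd.sum_lie_left (β.compl₂ (ad ℂ g y)) x
    simp only [LinearMap.compl₂_apply, ad_apply] at this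
    rw [← this]
    refine Finset.sum_congr rfl fun i _ ↦ ?_
    rw [← lie_skew x (b i), ← lie_skew y (d i)]
    simp only [map_neg, LinearMap.neg_apply, neg_neg]
  have h2 : ∑ i, β ⁅b i, x⁆ ⁅d i, y⁆ = ∑ i, β (b i) ⁅x, ⁅y, d i⁆⁆ := by
    have h3 := hbd.sum_lie_left (β.compl₂ (ad ℂ g x)) y
    have h4 := hbd.sum_symm (β.compl₁₂ (ad ℂ g y) (ad ℂ g x))
    simp only [LinearMap.compl₂_apply, LinearMap.compl₁₂_apply, ad_apply] at h3 h4
    rw [← neg_eq_iff_eq_neg] at h3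
    rw [← h3, h4, ← Finset.sum_neg_distrib]
    refine Finset.sum_congr rfl fun i _ ↦ ?_
    rw [← halt, ← lie_skew x (b i), ← lie_skew y (d i)]
    simp only [map_neg, LinearMap.neg_apply, neg_neg]
  have h3 (i : ι) : ⁅⁅x, y⁆, d i⁆ = ⁅x, ⁅y, d i⁆⁆ - ⁅y, ⁅x, d i⁆⁆ := lie_lie ..
  simp only [h3, map_sub, Finset.sum_sub_distrib]
  linear_combination h1 + h2

end BilinearMaps

section CurvatureSystem

variable {g : Type*} [LieRing g] [LieAlgebra ℂ g] [Module.Finite ℂ g]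

local notation "κ" => killingForm ℂ _
local notation "tr" => LinearMap.trace ℂ _

lemma trace_wedge_mul_ad (x y u : g) : tr (wedge ℂ g x y * ad ℂ g u) = 2 * κ ⁅x, y⁆ u := by
  rw [wedge, sub_mul, map_sub, trace_smulRight_mul, trace_smulRight_mul]
  have h1 : κ ⁅x, y⁆ u = κ x ⁅y, u⁆ := LieModule.traceForm_apply_lie_apply ..
  have h2 : κ y ⁅u, x⁆ = - κ ⁅u, y⁆ x := by rw [killingForm_lie_left, neg_neg]
  rw [h1, LinearMap.neg_apply, LinearMap.neg_apply, ad_apply, ad_apply, h2, killingForm_symm,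
    ← lie_skew y u, map_neg, killingForm_symm x]
  ring

variable [IsKilling ℂ g] {K Φ : g →ₗ[ℂ] g →ₗ[ℂ] g}
  (hskew : ∀ z x y, κ (K z x) y = - κ x (K z y))
  (htr : ∀ z u, tr (K z * ad ℂ g u) = 0)
include hskew htr

lemma trace_mul_ad_mul_ad_eq_zero (z u v : g) : tr (K z * ad ℂ g u * ad ℂ g v) = 0 := by
  rw [trace_skew_mul_ad_mul_ad (hskew z), htr, zero_div]

lemma bianchi_of_curvature_system
    (hii : ∀ x y z : g,
      (⁅ad ℂ g ⁅x, y⁆, K z⁆ + ad ℂ g ⁅K x y - K y x, z⁆ + wedge ℂ g (Φ x y) z)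
      + (⁅ad ℂ g ⁅y, z⁆, K x⁆ + ad ℂ g ⁅K y z - K z y, x⁆ + wedge ℂ g (Φ y z) x)
      + (⁅ad ℂ g ⁅z, x⁆, K y⁆ + ad ℂ g ⁅K z x - K x z, y⁆ + wedge ℂ g (Φ z x) y) = 0)
    (x y z : g) :
    ⁅K x y - K y x + (2 : ℂ) • Φ x y, z⁆ + ⁅K y z - K z y + (2 : ℂ) • Φ y z, x⁆
      + ⁅K z x - K x z + (2 : ℂ) • Φ z x, y⁆ = 0 := by
  refine killingForm_ext fun u ↦ ?_
  have hK (p z : g) : tr (⁅ad ℂ g p, K z⁆ * ad ℂ g u) = 0 := by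
    have h : tr (ad ℂ g p * K z * ad ℂ g u) = tr (K z * ad ℂ g u * ad ℂ g p) := by
      rw [mul_assoc, LinearMap.trace_mul_comm]
    rw [Ring.lie_def, sub_mul, map_sub, h, trace_mul_ad_mul_ad_eq_zero hskew htr,
      trace_mul_ad_mul_ad_eq_zero hskew htr, sub_zero]
  have h := congrArg (fun S ↦ tr (S * ad ℂ g u)) (hii x y z)
  simp only [add_mul, map_add, hK, trace_wedge_mul_ad, ← killingForm_eq_trace_mul, zero_mul,
    map_zero] at h
  simp only [add_lie, smul_lie, map_add, map_smul, LinearMap.add_apply, LinearMap.smul_apply,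
    smul_eq_mul, map_zero, LinearMap.zero_apply]
  linear_combination h

/-- The trace over `z` of the curvature identity applied to a vector `w`. -/
lemma trace_curvature_system (hΦ : ∀ x y, Φ x y = - Φ y x)
    (hii : ∀ x y z : g,
      (⁅ad ℂ g ⁅x, y⁆, K z⁆ + ad ℂ g ⁅K x y - K y x, z⁆ + wedge ℂ g (Φ x y) z)
      + (⁅ad ℂ g ⁅y, z⁆, K x⁆ + ad ℂ g ⁅K y z - K z y, x⁆ + wedge ℂ g (Φ y z) x)
      + (⁅ad ℂ g ⁅z, x⁆, K y⁆ + ad ℂ g ⁅K z x - K x z, y⁆ + wedge ℂ g (Φ z x) y) = 0)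
    (x y w : g) :
    ((Module.finrank ℂ g : ℂ) - 3) * κ (Φ x y) w =
      tr (ad ℂ g ⁅x, y⁆ * K.flip w) - tr (K.flip ⁅⁅x, y⁆, w⁆)
      - tr (ad ℂ g w * ad ℂ g x * K.flip y) + tr (ad ℂ g w * ad ℂ g y * K.flip x)
      + κ x w * tr (Φ y) - κ y w * tr (Φ x) := by
  have hop : ad ℂ g ⁅x, y⁆ * K.flip w - K.flip ⁅⁅x, y⁆, w⁆ - ad ℂ g w * ad ℂ g (K x y - K y x)
      - κ (Φ x y) w • (1 : Module.End ℂ g) + (κ w).smulRight (Φ x y)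
      - ad ℂ g (K x w) * ad ℂ g y + K x * ad ℂ g w * ad ℂ g y
      + ad ℂ g w * ad ℂ g x * (K y - K.flip y) - (κ w).smulRight x * Φ y + κ x w • Φ y
      + ad ℂ g (K y w) * ad ℂ g x - K y * ad ℂ g w * ad ℂ g x
      - ad ℂ g w * ad ℂ g y * (K x - K.flip x) + (κ w).smulRight y * Φ x - κ y w • Φ x = 0 := by
    ext z
    have h := LinearMap.congr_fun (hii x y z) w
    have e1 : ⁅⁅K x y - K y x, z⁆, w⁆ = - ⁅w, ⁅K x y - K y x, z⁆⁆ := (lie_skew _ _).symm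
    have e2 : ⁅⁅y, z⁆, K x w⁆ = - ⁅K x w, ⁅y, z⁆⁆ := (lie_skew _ _).symm
    have e3 : ⁅⁅y, z⁆, w⁆ = - ⁅w, ⁅y, z⁆⁆ := (lie_skew _ _).symm
    have e4 : ⁅⁅K y z - K z y, x⁆, w⁆ = ⁅w, ⁅x, K y z - K z y⁆⁆ := by
      rw [← lie_skew, ← lie_skew x, lie_neg]
    have e5 : ⁅⁅z, x⁆, K y w⁆ = ⁅K y w, ⁅x, z⁆⁆ := by rw [← lie_skew, ← lie_skew x, lie_neg]
    have e6 : ⁅⁅z, x⁆, w⁆ = ⁅w, ⁅x, z⁆⁆ := by rw [← lie_skew, ← lie_skew x, lie_neg]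
    have e7 : ⁅⁅K z x - K x z, y⁆, w⁆ = - ⁅w, ⁅y, K x z - K z x⁆⁆ := by
      rw [← neg_sub (K x z), neg_lie, neg_lie, ← lie_skew _ y, neg_lie, lie_skew, ← lie_skew]
    simp only [LinearMap.add_apply, LinearMap.sub_apply, Ring.lie_def, Module.End.mul_apply,
      ad_apply, wedge, LinearMap.smulRight_apply, LinearMap.neg_apply, e1, e2, e3, e4, e5, e6, e7,
      LinearMap.zero_apply, hΦ z x, map_neg, killingForm_symm (Φ y z) w, killingForm_symm z w,
      killingForm_symm (Φ x z) w] at h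
    simp only [LinearMap.add_apply, LinearMap.sub_apply, Module.End.mul_apply, ad_apply,
      LinearMap.smulRight_apply, LinearMap.smul_apply, LinearMap.flip_apply, Module.End.one_apply,
      LinearMap.zero_apply]
    rw [← h]
    module
  have h := congrArg (tr) hop
  have c1 : tr (ad ℂ g w * ad ℂ g x * K y) = 0 := by
    rw [LinearMap.trace_mul_comm, ← mul_assoc, trace_mul_ad_mul_ad_eq_zero hskew htr]
  have c2 : tr (ad ℂ g w * ad ℂ g y * K x) = 0 := by
    rw [LinearMap.trace_mul_comm, ← mul_assoc, trace_mul_ad_mul_ad_eq_zero hskew htr]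
  simp only [map_add, map_sub, map_smul, mul_sub, trace_smulRight_mul, LinearMap.trace_smulRight,
    ← killingForm_eq_trace_mul, c1, c2, trace_mul_ad_mul_ad_eq_zero hskew htr,
    LinearMap.trace_one, smul_eq_mul, map_zero, hskew, killingForm_symm w (Φ _ _), hΦ y x,
    map_neg] at h
  linear_combination -h

lemma trace_ad_mul_flip (hi : ∀ x y z, κ (Φ x y) z + κ (Φ y z) x + κ (Φ z x) y = 0)
    (hΦ : ∀ x y, Φ x y = - Φ y x) {θ : Module.End ℂ g}
    (hθ : ∀ x y, K x y - K y x + (2 : ℂ) • Φ x y = θ ⁅x, y⁆) (u y : g) :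
    tr (ad ℂ g u * K.flip y) = - tr (ad ℂ g u * θ * ad ℂ g y) / 2 - κ (θ u) y / 4 := by
  obtain ⟨b, d, hbd⟩ := exists_killingDual g
  have htrace (S : Module.End ℂ g) : ∑ i, κ (S (b i)) ⁅u, d i⁆ = - tr (ad ℂ g u * S) := by
    rw [hbd.trace_eq, ← Finset.sum_neg_distrib]
    refine Finset.sum_congr rfl fun i _ ↦ ?_
    rw [killingForm_symm, killingForm_lie_left, Module.End.mul_apply, ad_apply]
  have hanti (β : g →ₗ[ℂ] g →ₗ[ℂ] ℂ) : ∑ i, β ⁅u, d i⁆ (b i) = - ∑ i, β (b i) ⁅u, d i⁆ := by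
    rw [← hbd.sum_lie_left]
    exact (hbd.sum_symm (β ∘ₗ ad ℂ g u)).symm
  have k1 := htrace (K.flip y)
  have k2 := htrace (K y)
  rw [LinearMap.trace_mul_comm, htr, neg_zero] at k2
  have k3 : ∑ i, κ (K ⁅u, d i⁆ (b i)) y = - ∑ i, κ (K (b i) ⁅u, d i⁆) y :=
    hanti (K.compr₂ ((κ).flip y))
  have f2 : ∑ i, κ (Φ y ⁅u, d i⁆) (b i) = - ∑ i, κ (Φ y (b i)) ⁅u, d i⁆ :=
    hanti ((κ) ∘ₗ Φ y)
  have p1 := htrace (θ * ad ℂ g y)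
  have p2 : ∑ i, κ (θ ⁅b i, ⁅u, d i⁆⁆) y = - κ (θ u) y := by
    conv_rhs => rw [← hbd.sum_lie_lie u]
    simp only [map_sum, LinearMap.sum_apply, ← Finset.sum_neg_distrib]
    refine Finset.sum_congr rfl fun i _ ↦ ?_
    rw [← lie_skew u (d i), lie_neg, map_neg, map_neg, LinearMap.neg_apply]
  have k4 : ∑ i, κ (K (b i) ⁅u, d i⁆) y = - ∑ i, κ (K (b i) y) ⁅u, d i⁆ := by
    rw [← Finset.sum_neg_distrib]
    refine Finset.sum_congr rfl fun i _ ↦ ?_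
    rw [hskew, killingForm_symm]
  have f3 : 2 * ∑ i, κ (Φ y (b i)) ⁅u, d i⁆ + ∑ i, κ (Φ (b i) ⁅u, d i⁆) y = 0 := by
    have := Finset.sum_congr rfl fun i (_ : i ∈ Finset.univ) ↦ hi y (b i) ⁅u, d i⁆
    simp only [hΦ _ y, map_neg, LinearMap.neg_apply, Finset.sum_add_distrib,
      Finset.sum_neg_distrib, Finset.sum_const_zero] at this
    linear_combination this + f2
  simp only [LinearMap.flip_apply, Module.End.mul_apply, ad_apply, ← hθ,
    map_add, map_sub, map_smul, LinearMap.add_apply, LinearMap.sub_apply, LinearMap.smul_apply,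
    Finset.sum_add_distrib, Finset.sum_sub_distrib, ← Finset.mul_sum, smul_eq_mul, ← mul_assoc]
    at k1 k2 p1 p2
  rw [k2, k1] at p1
  rw [k3, k4, k1] at p2
  linear_combination p1 / 2 + p2 / 4 - f3 / 2

end CurvatureSystem

section CurvatureSolution

variable {g : Type*} [LieRing g] [LieAlgebra ℂ g]

local notation "κ" => killingForm ℂ _
local notation "tr" => LinearMap.trace ℂ _

lemma trace_ad_lie_mul_sub_trace_ad_lie_mul {L : g →ₗ[ℂ] Module.End ℂ g} {θ : Module.End ℂ g}
    (hL : ∀ u y, tr (ad ℂ g u * L y) = - tr (ad ℂ g u * θ * ad ℂ g y) / 2 - κ (θ u) y / 4)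
    (hθ : ∀ x y, ad ℂ g (θ ⁅x, y⁆) = ad ℂ g x * θ * ad ℂ g y - ad ℂ g y * θ * ad ℂ g x)
    (x y w : g) :
    tr (ad ℂ g ⁅x, w⁆ * L y) - tr (ad ℂ g ⁅y, w⁆ * L x) =
      (κ w (θ ⁅x, y⁆) + tr (ad ℂ g w * θ * ad ℂ g ⁅x, y⁆)) / 2
      + (tr (θ * ad ℂ g w * ad ℂ g ⁅x, y⁆) + tr (ad ℂ g w * θ * ad ℂ g ⁅x, y⁆)) / 4 := by
  have cyc (a b : Module.End ℂ g) (z : g) : tr (ad ℂ g z * a * b) = tr (a * b * ad ℂ g z) := by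
    rw [mul_assoc, LinearMap.trace_mul_comm]
  rw [hL, hL]
  simp only [killingForm_eq_trace_mul, hθ]
  simp only [ad_lie_eq, mul_sub, sub_mul, map_sub, ← mul_assoc]
  have e1 := cyc (ad ℂ g w * θ) (ad ℂ g y) x
  have e2 := cyc (ad ℂ g w * θ) (ad ℂ g x) y
  have e3 := cyc (θ * ad ℂ g w) (ad ℂ g y) x
  have e4 := cyc (θ * ad ℂ g w) (ad ℂ g x) y
  simp only [← mul_assoc] at e1 e2 e3 e4
  rw [e1, e2, e3, e4]
  ring

variable [Module.Finite ℂ g] [IsKilling ℂ g]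

lemma mem_bracketFactor_of_killingForm {m : g →ₗ[ℂ] g →ₗ[ℂ] g}
    (h : ∀ w, ∃ f : Module.Dual ℂ g, ∀ x y, κ (m x y) w = f ⁅x, y⁆) : m ∈ bracketFactor g := by
  obtain ⟨b, d, hbd⟩ := exists_killingDual g
  refine ⟨∑ i, m (b i) ∘ₗ ad ℂ g (d i), fun x y ↦ killingForm_ext fun w ↦ ?_⟩
  obtain ⟨f, hf⟩ := h w
  simp only [LinearMap.sum_apply, LinearMap.comp_apply, ad_apply, map_sum, hf]
  rw [← map_sum, hbd.sum_lie_lie]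

variable {K Φ : g →ₗ[ℂ] g →ₗ[ℂ] g}
  (hskew : ∀ z x y, κ (K z x) y = - κ x (K z y))
  (htr : ∀ z u, tr (K z * ad ℂ g u) = 0)
  {ι : Type*} [Fintype ι] {b d : ι → g} (hbd : KillingDual b d)
include hskew htr hbd

lemma KillingDual.casimirEnd_sub_flip (x y w : g) :
    κ (casimirEnd (g →ₗ[ℂ] g →ₗ[ℂ] g) b d (K - K.flip) x y) w = 3 * κ (K x y - K y x) w
      - 2 * tr (ad ℂ g w * K.flip y * ad ℂ g x) + 2 * tr (ad ℂ g w * K.flip x * ad ℂ g y)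
      + ∑ i, κ ((K - K.flip) (b i) ⁅⁅x, y⁆, d i⁆) w := by
  have htrace (S : Module.End ℂ g) (z : g) :
      ∑ i, κ (S ⁅d i, z⁆) ⁅b i, w⁆ = - tr (ad ℂ g w * S * ad ℂ g z) := by
    rw [hbd.symm.trace_eq, ← Finset.sum_neg_distrib]
    refine Finset.sum_congr rfl fun i _ ↦ ?_
    rw [← lie_skew, ← lie_skew (b i), map_neg, map_neg, map_neg, LinearMap.neg_apply, neg_neg,
      killingForm_symm, killingForm_lie_left]
    rfl
  have h0 (y z : g) : tr (ad ℂ g w * K y * ad ℂ g z) = 0 := by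
    rw [mul_assoc, LinearMap.trace_mul_comm, trace_mul_ad_mul_ad_eq_zero hskew htr]
  have h1 : ∑ i, κ ((K - K.flip) ⁅d i, x⁆ y) ⁅b i, w⁆ = - tr (ad ℂ g w * K.flip y * ad ℂ g x) := by
    have e := htrace (K.flip y - K y) x
    rw [mul_sub, sub_mul, map_sub, h0, sub_zero] at e
    exact e
  have h2 : ∑ i, κ ((K - K.flip) x ⁅d i, y⁆) ⁅b i, w⁆ = tr (ad ℂ g w * K.flip x * ad ℂ g y) := by
    have e := htrace (K x - K.flip x) y
    rw [mul_sub, sub_mul, map_sub, h0, zero_sub, neg_neg] at e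
    exact e
  have h3 : 2 * ∑ i, κ ((K - K.flip) ⁅b i, x⁆ ⁅d i, y⁆) w =
      ∑ i, κ ((K - K.flip) (b i) ⁅⁅x, y⁆, d i⁆) w :=
    hbd.sum_lie_lie_of_alternating ((K - K.flip).compr₂ ((κ).flip w)) (fun x y ↦ by simp) x y
  rw [hbd.casimirEnd_bilinear, h1, h2, h3]
  simp only [LinearMap.sub_apply, LinearMap.flip_apply]
  ring

lemma KillingDual.casimirEnd_sub_flip_mem (hΦ : ∀ x y, Φ x y = - Φ y x)
    (hi : ∀ x y z, κ (Φ x y) z + κ (Φ y z) x + κ (Φ z x) y = 0)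
    (hii : ∀ x y z : g,
      (⁅ad ℂ g ⁅x, y⁆, K z⁆ + ad ℂ g ⁅K x y - K y x, z⁆ + wedge ℂ g (Φ x y) z)
      + (⁅ad ℂ g ⁅y, z⁆, K x⁆ + ad ℂ g ⁅K y z - K z y, x⁆ + wedge ℂ g (Φ y z) x)
      + (⁅ad ℂ g ⁅z, x⁆, K y⁆ + ad ℂ g ⁅K z x - K x z, y⁆ + wedge ℂ g (Φ z x) y) = 0)
    {θ : Module.End ℂ g} (hθ : ∀ x y, K x y - K y x + (2 : ℂ) • Φ x y = θ ⁅x, y⁆) :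
    casimirEnd (g →ₗ[ℂ] g →ₗ[ℂ] g) b d (K - K.flip)
      + ((Module.finrank ℂ g : ℂ) - 6) • (K - K.flip)
      + (2 : ℂ) • alternatingOf ((tr) ∘ₗ Φ) ∈ bracketFactor g := by
  refine mem_bracketFactor_of_killingForm fun w ↦ ?_
  have hB (x y : g) :
      ad ℂ g (θ ⁅x, y⁆) = ad ℂ g x * θ * ad ℂ g y - ad ℂ g y * θ * ad ℂ g x := by
    ext z
    have h := bianchi_of_curvature_system hskew htr hii x y z
    rw [hθ, hθ, hθ, ← lie_skew (θ ⁅y, z⁆), ← lie_skew (θ ⁅z, x⁆), ← lie_skew z x, map_neg, lie_neg]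
      at h
    simp only [ad_apply, LinearMap.sub_apply, Module.End.mul_apply]
    rw [← sub_eq_zero, ← h]
    abel
  have hL := trace_ad_lie_mul_sub_trace_ad_lie_mul (L := K.flip)
    (trace_ad_mul_flip hskew htr hi hΦ hθ) hB
  have hcomm (x y : g) : tr (ad ℂ g w * K.flip y * ad ℂ g x) =
      tr (ad ℂ g w * ad ℂ g x * K.flip y) + tr (ad ℂ g ⁅x, w⁆ * K.flip y) := by
    rw [LinearMap.trace_mul_comm, ← mul_assoc, ad_lie_eq, sub_mul, map_sub]
    ring
  let f : Module.Dual ℂ g := ((Module.finrank ℂ g : ℂ) - 3) • (κ w ∘ₗ θ)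
    - (2 : ℂ) • ((tr) ∘ₗ LinearMap.mulRight ℂ (K.flip w) ∘ₗ (ad ℂ g : g →ₗ[ℂ] Module.End ℂ g))
    + (2 : ℂ) • ((tr) ∘ₗ K.flip ∘ₗ (-ad ℂ g w : Module.End ℂ g))
    - κ w ∘ₗ θ
    - (3 / 2 : ℂ) • ((tr) ∘ₗ LinearMap.mulLeft ℂ (ad ℂ g w * θ) ∘ₗ
        (ad ℂ g : g →ₗ[ℂ] Module.End ℂ g))
    - (1 / 2 : ℂ) • ((tr) ∘ₗ LinearMap.mulLeft ℂ (θ * ad ℂ g w) ∘ₗ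
        (ad ℂ g : g →ₗ[ℂ] Module.End ℂ g))
    + ∑ i, κ w ∘ₗ (K - K.flip) (b i) ∘ₗ (-ad ℂ g (d i) : Module.End ℂ g)
  refine ⟨f, fun x y ↦ ?_⟩
  have hf (p : g) : f p = ((Module.finrank ℂ g : ℂ) - 3) * κ (θ p) w
      - 2 * tr (ad ℂ g p * K.flip w) + 2 * tr (K.flip ⁅p, w⁆) - κ w (θ p)
      - 3 / 2 * tr (ad ℂ g w * θ * ad ℂ g p) - 1 / 2 * tr (θ * ad ℂ g w * ad ℂ g p)
      + ∑ i, κ ((K - K.flip) (b i) ⁅p, d i⁆) w := by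
    have h1 : K.flip ⁅p, w⁆ = K.flip (-⁅w, p⁆) := by rw [lie_skew]
    have h2 (i : ι) : κ ((K - K.flip) (b i) ⁅p, d i⁆) w =
      κ w ((K - K.flip) (b i) (-⁅d i, p⁆)) := by rw [lie_skew, killingForm_symm]
    simp only [h1, h2, killingForm_symm (θ p) w]
    simp only [f, LinearMap.add_apply, LinearMap.sub_apply, LinearMap.smul_apply,
      LinearMap.comp_apply, LinearMap.mulRight_apply, LinearMap.mulLeft_apply,
      LieHom.coe_toLinearMap, LinearMap.neg_apply, ad_apply, LinearMap.sum_apply, smul_eq_mul]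
  have h1 := hbd.casimirEnd_sub_flip hskew htr x y w
  have h2 := trace_curvature_system hskew htr hΦ hii x y w
  have h3 := congrArg (fun z ↦ κ z w) (hθ x y)
  rw [hcomm, hcomm] at h1
  simp only [map_add, map_sub, map_smul, LinearMap.add_apply, LinearMap.sub_apply,
    LinearMap.smul_apply, smul_eq_mul] at h3
  simp only [LinearMap.add_apply, LinearMap.smul_apply, map_add, map_smul, smul_eq_mul, h1, hf]
  simp only [LinearMap.sub_apply, LinearMap.flip_apply, alternatingOf_apply, map_sub, map_smul,
    LinearMap.smul_apply, LinearMap.comp_apply, smul_eq_mul]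
  linear_combination -2 * hL x y w - 2 * h2 + ((Module.finrank ℂ g : ℂ) - 3) * h3

end CurvatureSolution

section CasimirShift

open scoped ComplexOrder

variable {g : Type*} [LieRing g] [LieAlgebra ℂ g] [Module.Finite ℂ g] [IsSimple ℂ g]
  [IsKilling ℂ g] {ι : Type*} [Fintype ι] {b d : ι → g}

/-- A positive shift of the Casimir operator reflects membership in a Lie submodule. -/
lemma KillingDual.mem_of_casimirEnd_add_smul_mem (hbd : KillingDual b d) {h e f : g}
    (t : IsSl2Triple h e f) {V : Type*} [AddCommGroup V] [Module ℂ V] [LieRingModule g V]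
    [LieModule ℂ g V] [Module.Finite ℂ V] (N : LieSubmodule ℂ g V) {c : ℂ} (hc : 0 < c) {v : V}
    (hv : casimirEnd V b d v + c • v ∈ N) : v ∈ N := by
  let S : Module.End ℂ V := casimirEnd V b d + c • 1
  have hS (v : V) : S v = casimirEnd V b d v + c • v := by simp [S]
  have hinj : Function.Injective S := by
    rw [← LinearMap.ker_eq_bot, LinearMap.ker_eq_bot']
    intro v hv
    by_contra hne
    have hev : (casimirEnd V b d).HasEigenvalue (-c) := by
      refine Module.End.hasEigenvalue_of_hasEigenvector (x := v)
        ⟨Module.End.mem_eigenspace_iff.mpr ?_, hne⟩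
      rw [neg_smul, eq_neg_iff_add_eq_zero, ← hS, hv]
    exact absurd (hbd.casimirEnd_eigenvalue_nonneg t hev) (by simpa using hc.not_ge)
  have hmaps : ∀ v ∈ N.toSubmodule, S v ∈ N.toSubmodule := fun v hv ↦ by
    rw [hS, casimirEnd_apply]
    exact N.add_mem (N.sum_mem fun i _ ↦ N.lie_mem (N.lie_mem hv)) (N.smul_mem c hv)
  have hinj' : Function.Injective (S.restrict hmaps) := fun u v huv ↦
    Subtype.ext (hinj (congrArg Subtype.val huv))
  obtain ⟨u, hu⟩ := LinearMap.surjective_of_injective hinj' ⟨S v, by rw [hS]; exact hv⟩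
  have huv : S u = S v := congrArg Subtype.val hu
  rw [← hinj huv]
  exact u.2

end CasimirShift

end LieAlgebra

theorem stmt_14 (g : Type*) [LieRing g] [LieAlgebra ℂ g] [Module.Finite ℂ g]
    [LieAlgebra.IsSimple ℂ g]
    (K : g →ₗ[ℂ] Module.End ℂ g)
    (hskew : ∀ Z X Y : g, ip ℂ g (K Z X) Y + ip ℂ g X (K Z Y) = 0)
    (htr : ∀ Z U : g, LinearMap.trace ℂ g (K Z ∘ₗ ad ℂ g U) = 0)
    (Φ : g →ₗ[ℂ] g →ₗ[ℂ] g)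
    (hΦalt : ∀ X : g, Φ X X = 0)
    (hi : ∀ X Y Z : g, ip ℂ g (Φ X Y) Z + ip ℂ g (Φ Y Z) X + ip ℂ g (Φ Z X) Y = 0)
    (hii : ∀ X Y Z : g,
      (⁅ad ℂ g ⁅X, Y⁆, K Z⁆ + ad ℂ g ⁅K X Y - K Y X, Z⁆ + wedge ℂ g (Φ X Y) Z)
      + (⁅ad ℂ g ⁅Y, Z⁆, K X⁆ + ad ℂ g ⁅K Y Z - K Z Y, X⁆ + wedge ℂ g (Φ Y Z) X)
      + (⁅ad ℂ g ⁅Z, X⁆, K Y⁆ + ad ℂ g ⁅K Z X - K X Z, Y⁆ + wedge ℂ g (Φ Z X) Y) = 0)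
    (hrank : ∃ h : LieSubalgebra ℂ g, h.IsCartanSubalgebra ∧ Module.finrank ℂ h = 2) :
    ∃ φ : g → ℂ,
      (∀ (c : ℂ) (X : g), φ (c • X) = c * φ X)
      ∧ (∀ Z : g, Z ≠ 0 → ∀ X Y : g, ⁅Z, X⁆ = 0 → ⁅Z, Y⁆ = 0 → φ (X + Y) = φ X + φ Y)
      ∧ (∀ X Y : g, ⁅X, Y⁆ = 0 → Φ X Y = φ Y • X - φ X • Y) := by
  obtain ⟨H, hH, hH2⟩ := hrank
  have hskew' (z x y : g) : killingForm ℂ g (K z x) y = - killingForm ℂ g x (K z y) := by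
    have := hskew z x y
    simp only [ip] at this
    linear_combination -this
  have hi' (x y z : g) : killingForm ℂ g (Φ x y) z + killingForm ℂ g (Φ y z) x
      + killingForm ℂ g (Φ z x) y = 0 := by
    have := hi x y z
    simp only [ip] at this
    linear_combination -this
  have hΦ (x y : g) : Φ x y = - Φ y x := by
    have := hΦalt (x + y)
    simp only [map_add, LinearMap.add_apply, hΦalt, zero_add, add_zero] at this
    exact eq_neg_of_add_eq_zero_right this
  obtain ⟨θ, hθ⟩ := exists_eq_apply_lie_of_bianchi (K - K.flip + (2 : ℂ) • Φ)
    (fun x y ↦ by simp [hΦ y x, add_comm])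
    (bianchi_of_curvature_system hskew' htr hii)
  replace hθ : ∀ x y, K x y - K y x + (2 : ℂ) • Φ x y = θ ⁅x, y⁆ := hθ
  obtain ⟨b, d, hbd⟩ := exists_killingDual g
  obtain ⟨α, hα⟩ := exists_weight_isNonZero hH2
  obtain ⟨h, e, f, t, -, -⟩ := IsKilling.exists_isSl2Triple_of_weight_isNonZero hα
  have hn : 7 ≤ Module.finrank ℂ g := seven_le_finrank hH2
  set n : ℂ := (Module.finrank ℂ g : ℂ) with hn_def
  have hn5 : n - 5 ≠ 0 := by
    rw [hn_def, sub_ne_zero]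
    exact_mod_cast (by omega : Module.finrank ℂ g ≠ 5)
  let τ : Module.Dual ℂ g := LinearMap.trace ℂ g ∘ₗ Φ
  obtain ⟨q, hq⟩ : (K - K.flip) + (2 / (n - 5)) • alternatingOf τ ∈ bracketFactor g := by
    refine hbd.mem_of_casimirEnd_add_smul_mem t (bracketFactor g) (c := n - 6) ?_ ?_
    · rw [Complex.lt_def]
      constructor <;> simp [n]
      omega
    · convert hbd.casimirEnd_sub_flip_mem hskew' htr hΦ hi' hii hθ using 1
      rw [map_add, map_smul, hbd.casimirEnd_alternatingOf]
      have : (2 / (n - 5)) + (n - 6) * (2 / (n - 5)) = 2 := by field_simp; ring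
      calc _ = casimirEnd (g →ₗ[ℂ] g →ₗ[ℂ] g) b d (K - K.flip) + (n - 6) • (K - K.flip)
            + (2 / (n - 5) + (n - 6) * (2 / (n - 5))) • alternatingOf τ := by module
        _ = _ := by rw [this]
  refine ⟨fun x ↦ τ x / (n - 5), fun c x ↦ by simp [mul_div_assoc],
    fun _ _ x y _ _ ↦ by simp only [map_add, add_div], fun x y hxy ↦ ?_⟩
  have h1 := hq x y
  have h2 := hθ x y
  rw [hxy, map_zero] at h1 h2
  simp only [LinearMap.add_apply, LinearMap.sub_apply, LinearMap.flip_apply,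
    LinearMap.smul_apply, alternatingOf_apply] at h1
  have h3 : (2 : ℂ) • Φ x y = (2 : ℂ) • ((τ y / (n - 5)) • x - (τ x / (n - 5)) • y) := by
    rw [← sub_eq_zero]
    calc _ = (K x y - K y x + (2 : ℂ) • Φ x y)
          - (K x y - K y x + (2 / (n - 5)) • (τ y • x - τ x • y)) := by module
      _ = 0 := by rw [h1, h2, sub_zero]
  exact smul_right_injective g two_ne_zero h3
end

section
/- Let φ : sl(3,ℂ) → ℂ be a function which is homogeneous of degree one (φ(cX) = cφ(X) for all c ∈ ℂ and X ∈ sl(3,ℂ)) and whose restriction to the centralizer of every nonzero element of sl(3,ℂ) is ℂ-linear. Then φ is ℂ-linear on all of sl(3,ℂ). -/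
open LieAlgebra

namespace SlThree

open Matrix

/-- The traceless part of a `3 × 3` matrix. -/
noncomputable def tracelessPart :
    Matrix (Fin 3) (Fin 3) ℂ →ₗ[ℂ] LieAlgebra.SpecialLinear.sl (Fin 3) ℂ where
  toFun M := ⟨M - (M.trace / 3) • (1 : Matrix (Fin 3) (Fin 3) ℂ), by
    change (M - (M.trace / 3) • (1 : Matrix (Fin 3) (Fin 3) ℂ)).trace = 0
    simp [Matrix.trace_sub, Matrix.trace_smul]⟩
  map_add' M N := by
    ext : 1
    change M + N - ((M + N).trace / 3) • 1 = (M - (M.trace / 3) • 1) + (N - (N.trace / 3) • 1)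
    rw [Matrix.trace_add]
    module
  map_smul' c M := by
    ext : 1
    change c • M - ((c • M).trace / 3) • 1 = c • (M - (M.trace / 3) • 1)
    rw [Matrix.trace_smul, smul_eq_mul]
    module

lemma coe_tracelessPart (M : Matrix (Fin 3) (Fin 3) ℂ) :
    (tracelessPart M : Matrix (Fin 3) (Fin 3) ℂ) = M - (M.trace / 3) • 1 := rfl

lemma tracelessPart_one : tracelessPart 1 = 0 := by
  ext : 1
  simp [coe_tracelessPart]

lemma tracelessPart_coe (X : LieAlgebra.SpecialLinear.sl (Fin 3) ℂ) :
    tracelessPart X.1 = X := by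
  have hX : X.1.trace = 0 := X.2
  ext : 1
  simp [coe_tracelessPart, hX]

lemma lie_tracelessPart {Z M : Matrix (Fin 3) (Fin 3) ℂ} (h : Commute Z M) :
    ⁅tracelessPart Z, tracelessPart M⁆ = 0 := by
  ext : 1
  change ⁅tracelessPart Z, tracelessPart M⁆.val = 0
  rw [SpecialLinear.sl_bracket, coe_tracelessPart, coe_tracelessPart, sub_eq_zero]
  exact (h.sub_left ((Commute.one_left M).smul_left _)).sub_right
    ((Commute.one_right _).smul_right _)

lemma tracelessPart_vecMulVec_ne_zero {w h : Fin 3 → ℂ} (hw : w ≠ 0) (hh : h ≠ 0) :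
    tracelessPart (vecMulVec w h) ≠ 0 := by
  intro H
  have H' := congrArg Subtype.val H
  change (tracelessPart (vecMulVec w h)).1 = 0 at H'
  rw [coe_tracelessPart, sub_eq_zero] at H'
  have hd := congrArg Matrix.det H'
  have h0 : (vecMulVec w h).det = 0 := by
    simp [Matrix.det_fin_three, vecMulVec_apply]
    ring
  rw [h0, Matrix.det_smul, Matrix.det_one, mul_one] at hd
  rw [pow_eq_zero_iff (by simp) |>.1 hd.symm, zero_smul, vecMulVec_eq_zero] at H'
  tauto

lemma exists_ne_zero_dotProduct_eq_zero (f g : Fin 3 → ℂ) :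
    ∃ w : Fin 3 → ℂ, w ≠ 0 ∧ f ⬝ᵥ w = 0 ∧ g ⬝ᵥ w = 0 := by
  have hdet : (Matrix.of ![f, g, g]).det = 0 :=
    Matrix.det_zero_of_row_eq (i := 1) (j := 2) (by decide) rfl
  obtain ⟨w, hw, h⟩ := Matrix.exists_mulVec_eq_zero_iff.2 hdet
  exact ⟨w, hw, congrFun h 0, congrFun h 1⟩

lemma commute_vecMulVec {w h : Fin 3 → ℂ} {M : Matrix (Fin 3) (Fin 3) ℂ}
    (h₁ : M *ᵥ w = 0) (h₂ : h ᵥ* M = 0) : Commute (vecMulVec w h) M := by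
  rw [Commute, SemiconjBy, vecMulVec_mul, mul_vecMulVec, h₁, h₂]
  simp

lemma vecMulVec_mulVec_eq_zero {u g w : Fin 3 → ℂ} (h : g ⬝ᵥ w = 0) :
    vecMulVec u g *ᵥ w = 0 := by
  simp [vecMulVec_mulVec, h]

lemma vecMul_vecMulVec_eq_zero {u g w : Fin 3 → ℂ} (h : w ⬝ᵥ u = 0) :
    w ᵥ* vecMulVec u g = 0 := by
  simp [vecMul_vecMulVec, h]

/-- Decomposition of a matrix with left kernel vector `f` into matrices of rank at most one, whose
columns are annihilated by `f` when `f k ≠ 0`, and whose row spaces are spanned by rows of `X`. -/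
lemma eq_sum_vecMulVec {X : Matrix (Fin 3) (Fin 3) ℂ} {f : Fin 3 → ℂ} (hf : f ᵥ* X = 0)
    (k : Fin 3) :
    X = ∑ i, vecMulVec (Pi.single i 1 - (f i / f k) • Pi.single k 1) (X i) := by
  ext a b
  have h : ∑ i, f i * X i b = 0 := congrFun hf b
  have h' : ∑ i, f i / f k * X i b = 0 := by
    simp_rw [div_mul_eq_mul_div, ← Finset.sum_div, h, zero_div]
  simp only [Matrix.sum_apply, vecMulVec_apply, Pi.sub_apply, Pi.smul_apply, smul_eq_mul, sub_mul,
    Finset.sum_sub_distrib]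
  rw [Finset.sum_congr rfl fun i _ => mul_right_comm (f i / f k) _ (X i b), ← Finset.sum_mul, h']
  simp [Pi.single_apply]

/-- `ψ` is additive on the matrices killed on the right by `w` and on the left by `h`,
for all nonzero `w` and `h`. -/
def AdditiveOnAnnihilators (ψ : Matrix (Fin 3) (Fin 3) ℂ → ℂ) : Prop :=
  ∀ w h : Fin 3 → ℂ, w ≠ 0 → h ≠ 0 → ∀ M N,
    M *ᵥ w = 0 → h ᵥ* M = 0 → N *ᵥ w = 0 → h ᵥ* N = 0 → ψ (M + N) = ψ M + ψ N

section Functional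

variable {ψ : Matrix (Fin 3) (Fin 3) ℂ → ℂ}

lemma map_vecMulVec_add (hadd : AdditiveOnAnnihilators ψ) (v f g : Fin 3 → ℂ) :
    ψ (vecMulVec v (f + g)) = ψ (vecMulVec v f) + ψ (vecMulVec v g) := by
  obtain ⟨w, hw, hfw, hgw⟩ := exists_ne_zero_dotProduct_eq_zero f g
  obtain ⟨h, hh, hv, -⟩ := exists_ne_zero_dotProduct_eq_zero v v
  rw [dotProduct_comm] at hv
  rw [vecMulVec_add]
  exact hadd w h hw hh _ _ (vecMulVec_mulVec_eq_zero hfw) (vecMul_vecMulVec_eq_zero hv)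
    (vecMulVec_mulVec_eq_zero hgw) (vecMul_vecMulVec_eq_zero hv)

lemma map_add_vecMulVec (hadd : AdditiveOnAnnihilators ψ) (u v f : Fin 3 → ℂ) :
    ψ (vecMulVec (u + v) f) = ψ (vecMulVec u f) + ψ (vecMulVec v f) := by
  obtain ⟨h, hh, hu, hv⟩ := exists_ne_zero_dotProduct_eq_zero u v
  obtain ⟨w, hw, hf, -⟩ := exists_ne_zero_dotProduct_eq_zero f f
  rw [dotProduct_comm] at hu hv
  rw [add_vecMulVec]
  exact hadd w h hw hh _ _ (vecMulVec_mulVec_eq_zero hf) (vecMul_vecMulVec_eq_zero hu)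
    (vecMulVec_mulVec_eq_zero hf) (vecMul_vecMulVec_eq_zero hv)

variable (hsmul : ∀ (c : ℂ) M, ψ (c • M) = c * ψ M) (hadd : AdditiveOnAnnihilators ψ)

/-- The linear functional with the same values as `ψ` on matrices of rank at most one. -/
noncomputable def rankOneExtension : Matrix (Fin 3) (Fin 3) ℂ →ₗ[ℂ] ℂ where
  toFun M := ∑ i, ψ (vecMulVec (Pi.single i 1) (M i))
  map_add' M N := by
    rw [← Finset.sum_add_distrib]
    exact Finset.sum_congr rfl fun i _ => map_vecMulVec_add hadd _ _ _
  map_smul' c M := by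
    rw [RingHom.id_apply, smul_eq_mul, Finset.mul_sum]
    refine Finset.sum_congr rfl fun i _ => ?_
    rw [← hsmul, ← vecMulVec_smul]
    rfl

lemma rankOneExtension_vecMulVec (u g : Fin 3 → ℂ) :
    rankOneExtension hsmul hadd (vecMulVec u g) = ψ (vecMulVec u g) := by
  have hu : u = u 0 • Pi.single 0 1 + u 1 • Pi.single 1 1 + u 2 • Pi.single 2 1 := by
    ext i
    fin_cases i <;> simp
  have hrow (i : Fin 3) : vecMulVec u g i = u i • g := rfl
  conv_rhs => rw [hu]
  rw [map_add_vecMulVec hadd, map_add_vecMulVec hadd]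
  change ∑ i, ψ (vecMulVec (Pi.single i 1) (vecMulVec u g i)) = _
  simp only [Fin.sum_univ_three, hrow, vecMulVec_smul, smul_vecMulVec, hsmul]

lemma rankOneExtension_of_det_eq_zero {X : Matrix (Fin 3) (Fin 3) ℂ} (hX : X.det = 0) :
    rankOneExtension hsmul hadd X = ψ X := by
  obtain ⟨v, hv, hXv⟩ := Matrix.exists_mulVec_eq_zero_iff.2 hX
  obtain ⟨f, hf, hfX⟩ := Matrix.exists_vecMul_eq_zero_iff.2 hX
  obtain ⟨k, hk⟩ := Function.ne_iff.1 hf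
  have hdec := eq_sum_vecMulVec hfX k
  set u : Fin 3 → Fin 3 → ℂ := fun i => Pi.single i 1 - (f i / f k) • Pi.single k 1 with hu
  have hr (i : Fin 3) : vecMulVec (u i) (X i) *ᵥ v = 0 :=
    vecMulVec_mulVec_eq_zero (congrFun hXv i)
  have hl (i : Fin 3) : f ᵥ* vecMulVec (u i) (X i) = 0 := by
    refine vecMul_vecMulVec_eq_zero ?_
    have hk' : f k ≠ 0 := hk
    simp [hu, dotProduct_sub, hk']
  change X = ∑ i, vecMulVec (u i) (X i) at hdec
  rw [Fin.sum_univ_three] at hdec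
  have hψ : ψ X = ψ (vecMulVec (u 0) (X 0)) + ψ (vecMulVec (u 1) (X 1)) +
      ψ (vecMulVec (u 2) (X 2)) := by
    conv_lhs => rw [hdec]
    rw [hadd v f hv hf _ _ (by rw [add_mulVec, hr, hr, add_zero])
      (by rw [vecMul_add, hl, hl, add_zero]) (hr 2) (hl 2),
      hadd v f hv hf _ _ (hr 0) (hl 0) (hr 1) (hl 1)]
  rw [hψ]
  conv_lhs => rw [hdec]
  simp only [map_add, rankOneExtension_vecMulVec]

lemma eq_rankOneExtension (hone : ∀ (c : ℂ) M, ψ (M + c • 1) = ψ M)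
    (M : Matrix (Fin 3) (Fin 3) ℂ) : ψ M = rankOneExtension hsmul hadd M := by
  have hL : rankOneExtension hsmul hadd 1 = 0 := by
    have h₁ : rankOneExtension hsmul hadd (diagonal ![1, 1, 0]) = ψ (diagonal ![1, 1, 0]) :=
      rankOneExtension_of_det_eq_zero hsmul hadd (by simp [Fin.prod_univ_three])
    have h₂ : rankOneExtension hsmul hadd (diagonal ![0, 0, -1]) = ψ (diagonal ![0, 0, -1]) :=
      rankOneExtension_of_det_eq_zero hsmul hadd (by simp [Fin.prod_univ_three])
    have h₃ : (diagonal ![1, 1, 0] : Matrix (Fin 3) (Fin 3) ℂ) =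
        diagonal ![0, 0, -1] + (1 : ℂ) • 1 := by
      ext i j
      fin_cases i <;> fin_cases j <;> simp
    have h₄ := hone 1 (diagonal ![0, 0, -1])
    rw [← h₃, ← h₁, ← h₂, h₃, map_add, one_smul] at h₄
    simpa using h₄
  obtain ⟨c, hc⟩ := spectrum.nonempty_of_isAlgClosed_of_finiteDimensional ℂ M
  have hdet : (M - c • 1).det = 0 := by
    rw [spectrum.mem_iff, Matrix.isUnit_iff_isUnit_det, isUnit_iff_ne_zero, not_not,
      Algebra.algebraMap_eq_smul_one, ← neg_sub, Matrix.det_neg] at hc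
    simpa using hc
  have h := rankOneExtension_of_det_eq_zero hsmul hadd hdet
  rw [← hone c, sub_add_cancel, map_sub, map_smul, hL, smul_zero, sub_zero] at h
  exact h.symm

end Functional

end SlThree

theorem stmt_15
    (φ : LieAlgebra.SpecialLinear.sl (Fin 3) ℂ → ℂ)
    (hhom : ∀ (c : ℂ) (X : LieAlgebra.SpecialLinear.sl (Fin 3) ℂ), φ (c • X) = c * φ X)
    (hcent : ∀ Z : LieAlgebra.SpecialLinear.sl (Fin 3) ℂ, Z ≠ 0 →
      ∀ X Y : LieAlgebra.SpecialLinear.sl (Fin 3) ℂ,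
        ⁅Z, X⁆ = 0 → ⁅Z, Y⁆ = 0 → φ (X + Y) = φ X + φ Y) :
    IsLinearMap ℂ φ := by
  have hsmul (c : ℂ) (M : Matrix (Fin 3) (Fin 3) ℂ) :
      φ (SlThree.tracelessPart (c • M)) = c * φ (SlThree.tracelessPart M) := by
    rw [map_smul, hhom]
  have hlin := SlThree.eq_rankOneExtension (ψ := fun M => φ (SlThree.tracelessPart M)) hsmul
    (fun w h hw hh M N h₁ h₂ h₃ h₄ => by
      beta_reduce
      rw [map_add]
      exact hcent _ (SlThree.tracelessPart_vecMulVec_ne_zero hw hh) _ _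
        (SlThree.lie_tracelessPart (SlThree.commute_vecMulVec h₁ h₂))
        (SlThree.lie_tracelessPart (SlThree.commute_vecMulVec h₃ h₄)))
    (fun c M => by rw [map_add, map_smul, SlThree.tracelessPart_one, smul_zero, add_zero])
  refine ⟨fun X Y => ?_, hhom⟩
  have hX := hlin X.1
  have hY := hlin Y.1
  have hXY := hlin (X + Y).1
  rw [SlThree.tracelessPart_coe] at hX hY hXY
  rw [hX, hY, hXY]
  exact map_add _ X.1 Y.1
end
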